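/- Let M, N, G be finite simple undirected graphs with N and G each having at least one edge, let w be a weight function on G, and suppose mc_N(G,w) > 0. Let f : V(G) → V(N) be an optimal solution to (G,w) as an instance of Max N-Col, i.e. a vertex map whose measure (total weight of edges of G carried by f to edges of N) equals mc_N(G,w). Define the nonnegative weight w_f on N by w_f(e) = (Σ_{e' ∈ E(G), f maps e' to e} w(e')) / mc_N(G,w) for each edge e of N. Then mc_M(G,w) / mc_N(G,w) ≥ mc_M(N, w_f). -/

import Mathlib

open Finset
open scoped Classical

/-- The measure of a vertex map `f : V(G) → V(H)` as a solution to `(G,w)` of Max H-Col: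
the total `w`-weight of the edges of `G` carried by `f` to edges of `H`. -/
noncomputable def mcMeasure {V W : Type} [Fintype V] (G : SimpleGraph V) (H : SimpleGraph W)
    (w : Sym2 V → ℚ) (f : V → W) : ℚ :=
  ∑ e ∈ Finset.univ.filter (fun e : Sym2 V => e ∈ G.edgeSet ∧ Sym2.map f e ∈ H.edgeSet), w e

/-- `mc H (G,w)`: the maximum measure over all vertex maps `f : V(G) → V(H)`. -/
noncomputable def mc {V W : Type} [Fintype V] [Fintype W]
    (G : SimpleGraph V) (H : SimpleGraph W) (w : Sym2 V → ℚ) : ℝ :=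
  ⨆ f : V → W, (mcMeasure G H w f : ℝ)

/-- A weight function on `G`: positive rational weights on the edges of `G`. -/
def IsWeight {V : Type} (G : SimpleGraph V) (w : Sym2 V → ℚ) : Prop :=
  ∀ e ∈ G.edgeSet, 0 < w e

/-- A sum over edges of `N` carried by `g` to edges of `M` of the weights of the fibres of `f`
is at most the measure of `g ∘ f`. -/
theorem sum_fiber_le_mcMeasure_comp {A B C : Type} [Fintype A] [Fintype B]
    (G : SimpleGraph A) (N : SimpleGraph B) (M : SimpleGraph C)
    (w : Sym2 A → ℚ) (hw : IsWeight G w) (f : A → B) (g : B → C) :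
    ∑ e ∈ Finset.univ.filter (fun e : Sym2 B => e ∈ N.edgeSet ∧ Sym2.map g e ∈ M.edgeSet),
      ∑ e' ∈ Finset.univ.filter
        (fun e' : Sym2 A => e' ∈ G.edgeSet ∧ Sym2.map f e' = e), w e' ≤
      mcMeasure G M w (g ∘ f) := by
  rw [Finset.sum_comm' (s' := fun e' => {Sym2.map f e'})
    (t' := Finset.univ.filter (fun e' : Sym2 A => e' ∈ G.edgeSet ∧
      Sym2.map f e' ∈ N.edgeSet ∧ Sym2.map (g ∘ f) e' ∈ M.edgeSet))]
  · simp only [Finset.sum_singleton]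
    refine Finset.sum_le_sum_of_subset_of_nonneg ?_ ?_
    · intro e he
      simp only [Finset.mem_filter, Finset.mem_univ, true_and] at he ⊢
      exact ⟨he.1, he.2.2⟩
    · intro e he _
      exact (hw e (Finset.mem_filter.1 he).2.1).le
  · intro e e'
    simp only [Finset.mem_filter, Finset.mem_univ, true_and, Finset.mem_singleton,
      ← Sym2.map_map]
    constructor
    · rintro ⟨⟨h1, h2⟩, h3, rfl⟩
      exact ⟨rfl, h3, h1, h2⟩
    · rintro ⟨rfl, h3, h1, h2⟩
      exact ⟨⟨h1, h2⟩, h3, rfl⟩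

theorem mcMeasure_le_mc {V W : Type} [Fintype V] [Fintype W]
    (G : SimpleGraph V) (H : SimpleGraph W) (w : Sym2 V → ℚ) (f : V → W) :
    (mcMeasure G H w f : ℝ) ≤ mc G H w :=
  le_ciSup (f := fun f : V → W => (mcMeasure G H w f : ℝ)) (Set.finite_range _).bddAbove f

theorem mc_nonneg {V W : Type} [Fintype V] [Fintype W]
    (G : SimpleGraph V) (H : SimpleGraph W) (w : Sym2 V → ℚ) (hw : IsWeight G w) :
    0 ≤ mc G H w :=
  Real.iSup_nonneg fun _ => Rat.cast_nonneg.2 <|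
    Finset.sum_nonneg fun e he => (hw e (Finset.mem_filter.1 he).2.1).le

/-- if `f` is an optimal solution to `(G,w)` as an instance of Max N-Col
and `w_f` is the induced normalised weight on `N`, then
`mc_M(G,w)/mc_N(G,w) ≥ mc_M(N,w_f)`. -/
theorem stmt9 {A B C : Type} [Fintype A] [Fintype B] [Fintype C]
    (G : SimpleGraph A) (N : SimpleGraph B) (M : SimpleGraph C)
    (hG : G.edgeSet.Nonempty) (hN : N.edgeSet.Nonempty)
    (w : Sym2 A → ℚ) (hw : IsWeight G w)
    (hpos : 0 < mc G N w)
    (f : A → B) (hf : (mcMeasure G N w f : ℝ) = mc G N w)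
    (wf : Sym2 B → ℚ)
    (hwf : ∀ e ∈ N.edgeSet,
      (wf e : ℝ) =
        ((∑ e' ∈ Finset.univ.filter
            (fun e' : Sym2 A => e' ∈ G.edgeSet ∧ Sym2.map f e' = e), w e' : ℚ) : ℝ)
          / mc G N w) :
    mc N M wf ≤ mc G M w / mc G N w := by
  refine Real.iSup_le (fun g => ?_) (div_nonneg (mc_nonneg G M w hw) hpos.le)
  calc (mcMeasure N M wf g : ℝ)
      = ((∑ e ∈ Finset.univ.filter
            (fun e : Sym2 B => e ∈ N.edgeSet ∧ Sym2.map g e ∈ M.edgeSet),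
          ∑ e' ∈ Finset.univ.filter
            (fun e' : Sym2 A => e' ∈ G.edgeSet ∧ Sym2.map f e' = e), w e' : ℚ) : ℝ)
          / mc G N w := by
        rw [mcMeasure, Rat.cast_sum, Rat.cast_sum, Finset.sum_div]
        exact Finset.sum_congr rfl fun e he => hwf e (Finset.mem_filter.1 he).2.1
    _ ≤ mc G M w / mc G N w := by
        refine div_le_div_of_nonneg_right (le_trans ?_ (mcMeasure_le_mc G M w (g ∘ f))) hpos.le
        exact Rat.cast_le.2 (sum_fiber_le_mcMeasure_comp G N M w hw f g)
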